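/- Let p be a prime, r ≥ 1, and let H be a finite simple graph with no automorphism of order p. For every finite simple graph (G, ū) with r distinguished vertices and every r-tuple w̄ ∈ V(H)^r, there exist finitely many finite simple graphs G_1, ..., G_t such that |Orb_H(w̄)| · |Hom((G, ū),(H, w̄))| ≡ Σ_{s=1}^{t} |Hom(G_s, H)| (mod p), where Orb_H(w̄) = { (ρ(w_1),...,ρ(w_r)) : ρ an automorphism of H } is the orbit of w̄ under the automorphism group of H. -/

import Mathlib

attribute [local instance] Classical.propDecidable

/-- The number of homomorphisms from the graph `G` with distinguished vertices
`ub` to the graph `H` with distinguished vertices `wb`. -/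
noncomputable def homCount {VG VH : Type*} [Fintype VG] [Fintype VH]
    (G : SimpleGraph VG) (H : SimpleGraph VH) {r : ℕ}
    (ub : Fin r → VG) (wb : Fin r → VH) : ℕ :=
  Fintype.card {f : VG → VH //
    (∀ a b, G.Adj a b → H.Adj (f a) (f b)) ∧ ∀ i, f (ub i) = wb i}

/-- The total number of homomorphisms from `G` to `H`. -/
noncomputable def homCountAll {VG VH : Type*} [Fintype VG] [Fintype VH]
    (G : SimpleGraph VG) (H : SimpleGraph VH) : ℕ :=
  Fintype.card {f : VG → VH // ∀ a b, G.Adj a b → H.Adj (f a) (f b)}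

/-- `H` has an automorphism of order `p`: an automorphism `ρ ≠ id` with `ρ^p = id`. -/
def HasOrderPAut {VH : Type*} (p : ℕ) (H : SimpleGraph VH) : Prop :=
  ∃ ρ : H ≃g H, ρ.toEquiv ≠ Equiv.refl VH ∧ ρ.toEquiv ^ p = 1

/-- The orbit of the tuple `wb` under the automorphism group of `H`. -/
def tupleOrbit {VH : Type*} (H : SimpleGraph VH) {r : ℕ} (wb : Fin r → VH) :
    Set (Fin r → VH) :=
  {wb' | ∃ ρ : H ≃g H, ∀ i, ρ (wb i) = wb' i}

section Helpers

theorem homCountAll_eq {VG VH : Type*} [Fintype VG] [Fintype VH]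
    (G : SimpleGraph VG) (H : SimpleGraph VH) : homCountAll G H =
      Nat.card {f : VG → VH // ∀ a b, G.Adj a b → H.Adj (f a) (f b)} := by
  unfold homCountAll
  rw [← Nat.card_eq_fintype_card]

theorem ite_forall_eq_prod {ι R : Type*} [CommRing R] (D : Finset ι) (P : ι → Prop)
    [i1 : Decidable (∀ d ∈ D, P d)] [i2 : ∀ d, Decidable (P d)] :
    (if ∀ d ∈ D, P d then (1 : R) else 0) = ∏ d ∈ D, if P d then 1 else 0 := by
  by_cases h : ∀ d ∈ D, P d
  · rw [if_pos h, Finset.prod_eq_one]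
    intro d hd
    rw [if_pos (h d hd)]
  · rw [if_neg h]
    push Not at h
    obtain ⟨d, hd, hP⟩ := h
    exact (Finset.prod_eq_zero hd (if_neg hP)).symm

/-- Homomorphism counts into `H`, closed under finite sums, modulo `p`. -/
def HomSums (p : ℕ) {VH : Type*} [Fintype VH] (H : SimpleGraph VH) : AddSubmonoid (ZMod p) :=
  AddSubmonoid.closure {z | ∃ (n : ℕ) (G' : SimpleGraph (Fin n)), z = (homCountAll G' H : ZMod p)}

theorem HomSums.exists_sum {p : ℕ} {VH : Type*} [Fintype VH] {H : SimpleGraph VH} {z : ZMod p}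
    (hz : z ∈ HomSums p H) : ∃ (t : ℕ) (n : Fin t → ℕ) (G' : ∀ s, SimpleGraph (Fin (n s))),
      z = ∑ s, (homCountAll (G' s) H : ZMod p) := by
  obtain ⟨l, hl, rfl⟩ := AddSubmonoid.exists_list_of_mem_closure hz
  have h : ∀ s : Fin l.length, ∃ (n : ℕ) (G' : SimpleGraph (Fin n)),
      l.get s = (homCountAll G' H : ZMod p) := fun s => hl _ (List.get_mem l s)
  choose n G' hG using h
  refine ⟨l.length, n, G', ?_⟩
  rw [← Finset.sum_congr rfl (fun s _ => hG s)]
  simp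

theorem HomSums.mul_mem {p : ℕ} [NeZero p] {VH : Type*} [Fintype VH] {H : SimpleGraph VH}
    {z : ZMod p} (hz : z ∈ HomSums p H) (c : ZMod p) : c * z ∈ HomSums p H := by
  have := (HomSums p H).nsmul_mem hz c.val
  rwa [nsmul_eq_mul, ZMod.natCast_zmod_val] at this

theorem HomSums.constraint {p : ℕ} {VH : Type*} [Fintype VH] (H : SimpleGraph VH)
    {V : Type*} [Fintype V] (A E : V → V → Prop) :
    ((Nat.card {f : V → VH //
      (∀ a b, A a b → H.Adj (f a) (f b)) ∧ ∀ a b, E a b → f a = f b} : ℕ) : ZMod p)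
      ∈ HomSums p H := by
  by_cases hloop : ∃ a b, A a b ∧ Quot.mk E a = Quot.mk E b
  · obtain ⟨a, b, hab, hq⟩ := hloop
    have : IsEmpty {f : V → VH //
      (∀ a b, A a b → H.Adj (f a) (f b)) ∧ ∀ a b, E a b → f a = f b} := by
      refine ⟨fun f => ?_⟩
      have h1 := f.2.1 a b hab
      have h2 : f.1 a = f.1 b := congrArg (Quot.lift f.1 f.2.2) hq
      rw [h2] at h1
      exact H.irrefl h1
    rw [Nat.card_of_isEmpty]
    simp
  · have : Fintype (Quot E) := Fintype.ofFinite _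
    let e : Quot E ≃ Fin (Fintype.card (Quot E)) := Fintype.equivFin _
    let G' : SimpleGraph (Fin (Fintype.card (Quot E))) :=
      SimpleGraph.fromRel fun i j => ∃ a b, A a b ∧ e (Quot.mk E a) = i ∧ e (Quot.mk E b) = j
    apply AddSubmonoid.subset_closure
    refine ⟨_, G', ?_⟩
    rw [homCountAll_eq]
    congr 1
    refine Nat.card_congr ⟨fun f => ⟨fun i => Quot.lift f.1 f.2.2 (e.symm i), ?_⟩,
      fun g => ⟨fun a => g.1 (e (Quot.mk E a)), ?_, ?_⟩, ?_, ?_⟩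
    · intro i j hij
      rw [SimpleGraph.fromRel_adj] at hij
      obtain ⟨_, ⟨a, b, hab, rfl, rfl⟩ | ⟨a, b, hab, rfl, rfl⟩⟩ := hij
      · simpa using f.2.1 a b hab
      · simpa using (f.2.1 a b hab).symm
    · intro a b hab
      apply g.2
      rw [SimpleGraph.fromRel_adj]
      refine ⟨fun h => hloop ⟨a, b, hab, e.injective h⟩, Or.inl ⟨a, b, hab, rfl, rfl⟩⟩
    · intro a b hab
      dsimp only
      rw [Quot.sound hab]
    · intro f
      ext a
      simp
    · intro g
      ext i
      obtain ⟨q, rfl⟩ := e.surjective i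
      induction q using Quot.ind
      simp

/-- Homomorphism counts with an injectivity requirement, by inclusion-exclusion. -/
theorem HomSums.inj {p : ℕ} [NeZero p] {VH : Type*} [Fintype VH] (H : SimpleGraph VH)
    {V : Type*} [Fintype V] (A E : V → V → Prop) (D : Finset (V × V)) :
    ((Nat.card {f : V → VH //
      ((∀ a b, A a b → H.Adj (f a) (f b)) ∧ ∀ a b, E a b → f a = f b) ∧
        ∀ d ∈ D, f d.1 ≠ f d.2} : ℕ) : ZMod p) ∈ HomSums p H := by
  have key : ((Nat.card {f : V → VH //
      ((∀ a b, A a b → H.Adj (f a) (f b)) ∧ ∀ a b, E a b → f a = f b) ∧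
        ∀ d ∈ D, f d.1 ≠ f d.2} : ℕ) : ZMod p) =
      ∑ S ∈ D.powerset, (-1) ^ S.card * ((Nat.card {f : V → VH //
      (∀ a b, A a b → H.Adj (f a) (f b)) ∧ ∀ a b, (E a b ∨ (a, b) ∈ S) → f a = f b} : ℕ)
        : ZMod p) := by
    have h1 : ∀ P : (V → VH) → Prop, ((Nat.card {f : V → VH // P f} : ℕ) : ZMod p)
        = ∑ f, if P f then 1 else 0 := by
      intro P
      rw [Nat.card_eq_fintype_card, Fintype.card_subtype, Finset.sum_boole]
    simp only [h1, Finset.mul_sum]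
    rw [Finset.sum_comm]
    refine Finset.sum_congr rfl fun f _ => ?_
    by_cases hf : (∀ a b, A a b → H.Adj (f a) (f b)) ∧ ∀ a b, E a b → f a = f b
    · have h2 : ∀ S : Finset (V × V), ((∀ a b, A a b → H.Adj (f a) (f b)) ∧
          ∀ a b, (E a b ∨ (a, b) ∈ S) → f a = f b) ↔ ∀ d ∈ S, f d.1 = f d.2 := by
        intro S
        constructor
        · intro h d hd
          exact h.2 _ _ (Or.inr hd)
        · intro h
          refine ⟨hf.1, ?_⟩
          rintro a b (hab | hab)
          · exact hf.2 a b hab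
          · exact h _ hab
      have h2' : (((∀ a b, A a b → H.Adj (f a) (f b)) ∧ ∀ a b, E a b → f a = f b) ∧
          ∀ d ∈ D, f d.1 ≠ f d.2) ↔ ∀ d ∈ D, f d.1 ≠ f d.2 := ⟨fun h => h.2, fun h => ⟨hf, h⟩⟩
      simp only [h2, h2']
      have h3 : (if ∀ d ∈ D, f d.1 ≠ f d.2 then (1 : ZMod p) else 0)
          = ∏ d ∈ D, (1 + (-1) * (if f d.1 = f d.2 then 1 else 0)) := by
        rw [ite_forall_eq_prod D (fun d => f d.1 ≠ f d.2)]
        refine Finset.prod_congr rfl fun d _ => ?_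
        by_cases h : f d.1 = f d.2 <;> simp [h]
      rw [h3, Finset.prod_one_add]
      refine Finset.sum_congr rfl fun S _ => ?_
      rw [Finset.prod_mul_distrib, Finset.prod_const, ite_forall_eq_prod S (fun d => f d.1 = f d.2)]
    · rw [if_neg (fun h => hf h.1)]
      symm
      refine Finset.sum_eq_zero fun S _ => ?_
      rw [if_neg, mul_zero]
      exact fun h => hf ⟨h.1, fun a b hab => h.2 a b (Or.inl hab)⟩
  rw [key]
  refine AddSubmonoid.sum_mem _ fun S _ => HomSums.mul_mem ?_ _
  exact HomSums.constraint H A (fun a b => E a b ∨ (a, b) ∈ S)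

theorem finite_aut {VH : Type*} [Fintype VH] (H : SimpleGraph VH) : Finite (H ≃g H) :=
  Finite.of_injective (fun ρ : H ≃g H => (ρ : VH → VH)) DFunLike.coe_injective

theorem card_aut_ne_zero {p : ℕ} (hp : p.Prime) {VH : Type*} [Fintype VH] (H : SimpleGraph VH)
    (hH : ¬ HasOrderPAut p H) : ((Nat.card (H ≃g H) : ℕ) : ZMod p) ≠ 0 := by
  intro h
  rw [ZMod.natCast_eq_zero_iff] at h
  have := Fact.mk hp
  have := finite_aut H
  obtain ⟨ρ, hρ⟩ := exists_prime_orderOf_dvd_card' (G := H ≃g H) p h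
  refine hH ⟨ρ, fun h1 => ?_, ?_⟩
  · have : ρ = 1 := by
      ext x
      exact congrArg (fun e : VH ≃ VH => e x) h1
    rw [this, orderOf_one] at hρ
    exact hp.one_lt.ne hρ
  · have hpow : ∀ k : ℕ, ρ.toEquiv ^ k = (ρ ^ k).toEquiv := by
      intro k
      induction k with
      | zero => rfl
      | succ k ih => rw [pow_succ, pow_succ, ih]; rfl
    rw [hpow, ← hρ, pow_orderOf_eq_one]
    rfl

theorem card_aut_mul {VH : Type*} [Fintype VH] (H : SimpleGraph VH)
    {VG : Type*} [Fintype VG] (G : SimpleGraph VG) {r : ℕ}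
    (ub : Fin r → VG) (wb : Fin r → VH) :
    Nat.card (H ≃g H) * homCount G H ub wb = Nat.card {f : VH ⊕ VG → VH //
      ((∀ a b, (H.sum G).Adj a b → H.Adj (f a) (f b)) ∧
        ∀ a b, (∃ i, a = Sum.inl (wb i) ∧ b = Sum.inr (ub i)) → f a = f b) ∧
        ∀ d ∈ (Finset.univ.filter fun d : (VH ⊕ VG) × (VH ⊕ VG) =>
          ∃ x y, x ≠ y ∧ d = (Sum.inl x, Sum.inl y)), f d.1 ≠ f d.2} := by
  unfold homCount
  rw [← Nat.card_eq_fintype_card, ← Nat.card_prod]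
  refine Nat.card_eq_of_bijective
    (fun q => ⟨Sum.elim q.1 (fun v => q.1 (q.2.1 v)), ⟨?_, ?_⟩, ?_⟩) ⟨?_, ?_⟩
  · rintro (a | a) (b | b) hab
    · exact q.1.map_adj_iff.mpr (by simpa using hab)
    · simp at hab
    · simp at hab
    · exact q.1.map_adj_iff.mpr (q.2.2.1 a b (by simpa using hab))
  · rintro a b ⟨i, rfl, rfl⟩
    simp [q.2.2.2 i]
  · intro d hd
    simp only [Finset.mem_filter, Finset.mem_univ, true_and] at hd
    obtain ⟨x, y, hxy, rfl⟩ := hd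
    simpa using hxy
  · rintro ⟨ρ, f⟩ ⟨ρ', f'⟩ h
    have h := congrArg Subtype.val h
    dsimp only at h
    have hρ : ρ = ρ' := by
      ext x
      exact congrFun h (Sum.inl x)
    subst hρ
    have hf : f = f' := by
      ext v
      exact ρ.injective (congrFun h (Sum.inr v))
    rw [hf]
  · rintro ⟨h, ⟨hA, hE⟩, hD⟩
    have hinj : Function.Injective (fun x => h (Sum.inl x)) := by
      intro x y hxy
      by_contra hne
      exact hD (Sum.inl x, Sum.inl y) (by simpa using hne) hxy
    let φ : H →g H := ⟨fun x => h (Sum.inl x), fun {a b} hab => hA _ _ (by simpa using hab)⟩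
    have hbij : Function.Bijective φ := Finite.injective_iff_bijective.mp hinj
    -- the inverse preserves adjacency, by counting edges
    have hadj : ∀ a b, H.Adj (φ a) (φ b) → H.Adj a b := by
      let T := {d : VH × VH // H.Adj d.1 d.2}
      let F : T → T := fun d => ⟨(φ d.1.1, φ d.1.2), φ.map_adj d.2⟩
      have hF : Function.Injective F := by
        rintro ⟨⟨a, b⟩, h1⟩ ⟨⟨c, d⟩, h2⟩ h3
        have h4 := congrArg Subtype.val h3
        simp only [F, Prod.mk.injEq] at h4
        have h5 := hinj h4.1
        have h6 := hinj h4.2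
        subst h5 h6
        rfl
      intro a b hab
      obtain ⟨⟨⟨c, d⟩, h1⟩, h2⟩ := Finite.surjective_of_injective hF ⟨(φ a, φ b), hab⟩
      have h4 := congrArg Subtype.val h2
      simp only [F, Prod.mk.injEq] at h4
      have h5 := hinj h4.1
      have h6 := hinj h4.2
      subst h5 h6
      exact h1
    let ρ : H ≃g H := ⟨Equiv.ofBijective φ hbij, fun {a b} => ⟨hadj a b, fun hab => φ.map_adj hab⟩⟩
    have hρ : ∀ x, ρ x = h (Sum.inl x) := fun _ => rfl
    refine ⟨⟨ρ, fun v => ρ.symm (h (Sum.inr v)), ?_, ?_⟩, ?_⟩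
    · intro a b hab
      exact ρ.symm.map_adj_iff.mpr (hA _ _ (by simpa using hab))
    · intro i
      dsimp only
      rw [← hE _ _ ⟨i, rfl, rfl⟩, ← hρ]
      simp
    · ext (x | v)
      · simp [hρ]
      · simp

end Helpers

theorem stmt9 {p : ℕ} (hp : p.Prime) {r : ℕ} (hr : 1 ≤ r)
    {VH : Type*} [Fintype VH] (H : SimpleGraph VH)
    (hH : ¬ HasOrderPAut p H)
    {VG : Type*} [Fintype VG] (G : SimpleGraph VG)
    (ub : Fin r → VG) (wb : Fin r → VH) :
    ∃ (t : ℕ) (n : Fin t → ℕ) (G' : ∀ s, SimpleGraph (Fin (n s))),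
      ((tupleOrbit H wb).ncard : ZMod p) * (homCount G H ub wb : ZMod p)
        = ∑ s, (homCountAll (G' s) H : ZMod p) := by
  have : NeZero p := ⟨hp.ne_zero⟩
  have := Fact.mk hp
  apply HomSums.exists_sum
  apply HomSums.mul_mem
  have h0 := card_aut_ne_zero hp H hH
  have h1 := congrArg (Nat.cast : ℕ → ZMod p) (card_aut_mul H G ub wb)
  rw [Nat.cast_mul] at h1
  have h2 : (homCount G H ub wb : ZMod p) = ((Nat.card (H ≃g H) : ℕ) : ZMod p)⁻¹ *
      (((Nat.card (H ≃g H) : ℕ) : ZMod p) * (homCount G H ub wb : ZMod p)) := by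
    rw [inv_mul_cancel_left₀ h0]
  rw [h2, h1]
  exact HomSums.mul_mem (HomSums.inj H _ _ _) _
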